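/- For every integer j ≥ 1, the number of even lattice points lying in the topological interior of the region R(j) ∪ ([0,2j] × [−2j,0]) ⊆ ℝ² equals 3j² − 2j, which is the Seifert genus of the cable knot C(T(2,3); j, 6j+1) of the trefoil. -/

import Mathlib

open MeasureTheory Set ENNReal

/-- The recursively defined sequence of lattice points `(a_i^{(j)}, b_i^{(j)})`
(`ab j i` is `(a_i^{(j)}, b_i^{(j)})` for `1 ≤ i ≤ j+1`):
`[(a_i,b_i)^{(1)}] = [(1,3),(2,1)]`, and for `j ≥ 2`,
`(a_1,b_1)^{(j)} = (1, 2j+1)` and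
`(a_i,b_i)^{(j)} = (b_{j+2−i}^{(j−1)} + 1, a_{j+2−i}^{(j−1)} + 1)` for `2 ≤ i ≤ j+1`. -/
def ab : ℕ → ℕ → ℤ × ℤ
  | 0, _ => (0, 0)
  | 1, i => if i = 1 then (1, 3) else if i = 2 then (2, 1) else (0, 0)
  | (j + 2), i =>
      if i = 1 then (1, 2 * (j + 2) + 1)
      else ((ab (j + 1) ((j + 2) + 2 - i)).2 + 1, (ab (j + 1) ((j + 2) + 2 - i)).1 + 1)

/-- The region `R(j) = ⋃_{i=1}^{j+1} [0, a_i^{(j)}] × [0, b_i^{(j)}] ⊆ ℝ²`. -/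
def Rreg (j : ℕ) : Set (ℝ × ℝ) :=
  ⋃ i ∈ Finset.Icc 1 (j + 1),
    Set.Icc (0 : ℝ) ((ab j i).1 : ℝ) ×ˢ Set.Icc (0 : ℝ) ((ab j i).2 : ℝ)

/-- `p ∈ ℝ²` is an even lattice point: `p = (x,y)` with `x, y ∈ ℤ` and `x + y` even. -/
def IsEvenLatticePt (p : ℝ × ℝ) : Prop :=
  ∃ x y : ℤ, p.1 = (x : ℝ) ∧ p.2 = (y : ℝ) ∧ Even (x + y)

/-- The integer point `(x, y)` lies strictly below and to the left of a corner of `R(j)`. -/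
def BelowCorner (j : ℕ) (x y : ℤ) : Prop :=
  ∃ i, 1 ≤ i ∧ i ≤ j + 1 ∧ x < (ab j i).1 ∧ y < (ab j i).2

lemma ab_add_two_one (j : ℕ) : ab (j + 2) 1 = (1, 2 * ((j : ℤ) + 2) + 1) := by
  simp [ab]

lemma ab_add_two_of_ne_one (j i : ℕ) (hi : i ≠ 1) :
    ab (j + 2) i =
      ((ab (j + 1) (j + 2 + 2 - i)).2 + 1, (ab (j + 1) (j + 2 + 2 - i)).1 + 1) := by
  simp [ab, hi]

lemma ab_bounds (j i : ℕ) (h1 : 1 ≤ i) (h2 : i ≤ j + 2) :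
    1 ≤ (ab (j + 1) i).1 ∧ (ab (j + 1) i).1 ≤ 2 * (j + 1) ∧
      1 ≤ (ab (j + 1) i).2 ∧ (ab (j + 1) i).2 ≤ 2 * (j + 1) + 1 := by
  induction j generalizing i with
  | zero =>
    obtain rfl | rfl : i = 1 ∨ i = 2 := by omega
    all_goals simp [ab]
  | succ j ih =>
    by_cases hi : i = 1
    · subst hi
      rw [ab_add_two_one]
      dsimp only
      omega
    · have := ih (j + 2 + 2 - i) (by omega) (by omega)
      rw [ab_add_two_of_ne_one j i hi]
      push_cast
      omega

lemma ab_one_snd (j : ℕ) : (ab (j + 1) 1).2 = 2 * (j + 1) + 1 := by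
  cases j with
  | zero => simp [ab]
  | succ j => rw [ab_add_two_one]; push_cast; ring

lemma ab_last_fst (j : ℕ) : (ab (j + 1) (j + 2)).1 = 2 * (j + 1) := by
  cases j with
  | zero => simp [ab]
  | succ j =>
    rw [ab_add_two_of_ne_one j _ (by omega), show j + 2 + 2 - (j + 1 + 2) = 1 by omega,
      ab_one_snd]
    push_cast
    ring

lemma belowCorner_add_two (j : ℕ) (x y : ℤ) (hx : 1 ≤ x) :
    BelowCorner (j + 2) x y ↔ BelowCorner (j + 1) (y - 1) (x - 1) := by
  constructor
  · rintro ⟨i, h1, h2, ha, hb⟩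
    have hi : i ≠ 1 := by
      rintro rfl
      rw [ab_add_two_one] at ha
      dsimp only at ha
      omega
    rw [ab_add_two_of_ne_one j i hi] at ha hb
    dsimp only at ha hb
    exact ⟨j + 2 + 2 - i, by omega, by omega, by omega, by omega⟩
  · rintro ⟨i, h1, h2, ha, hb⟩
    refine ⟨j + 2 + 2 - i, by omega, by omega, ?_⟩
    rw [ab_add_two_of_ne_one j _ (by omega), show j + 2 + 2 - (j + 2 + 2 - i) = i by omega]
    dsimp only
    omega

lemma belowCorner_zero_left (j : ℕ) (y : ℤ) :
    BelowCorner (j + 1) 0 y ↔ y < 2 * (j + 1) + 1 := by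
  constructor
  · rintro ⟨i, h1, h2, -, hb⟩
    have := ab_bounds j i h1 h2
    omega
  · intro h
    have := ab_bounds j 1 le_rfl (by omega)
    have := ab_one_snd j
    exact ⟨1, le_rfl, by omega, by omega, by omega⟩

lemma belowCorner_zero_right (j : ℕ) (x : ℤ) :
    BelowCorner (j + 1) x 0 ↔ x < 2 * (j + 1) := by
  constructor
  · rintro ⟨i, h1, h2, ha, -⟩
    have := ab_bounds j i h1 h2
    omega
  · intro h
    have := ab_bounds j (j + 2) (by omega) le_rfl
    have := ab_last_fst j
    exact ⟨j + 2, by omega, le_rfl, by omega, by omega⟩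

/-- The even points with positive coordinates in the interior of `R(j + 1)`. -/
lemma exists_finset_upper (j : ℕ) :
    ∃ P : Finset (ℤ × ℤ), P.card = (j + 1) * j ∧
      ∀ x y : ℤ, (x, y) ∈ P ↔ 0 < x ∧ 0 < y ∧ BelowCorner (j + 1) x y ∧ Even (x + y) := by
  induction j with
  | zero =>
    refine ⟨∅, by simp, fun x y => ?_⟩
    simp only [Finset.notMem_empty, false_iff]
    rintro ⟨hx, hy, ⟨i, h1, h2, ha, hb⟩, -⟩
    obtain rfl | rfl : i = 1 ∨ i = 2 := by omega
    all_goals simp [ab] at ha hb; omega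
  | succ j ih =>
    obtain ⟨P, hc, hP⟩ := ih
    let Y : Finset (ℤ × ℤ) := (Finset.range (j + 2)).image fun k : ℕ => (0, 2 * (k : ℤ))
    let X : Finset (ℤ × ℤ) := (Finset.range j).image fun k : ℕ => (2 * (k : ℤ) + 2, 0)
    have hY : ∀ x y : ℤ, (x, y) ∈ Y ↔ x = 0 ∧ 0 ≤ y ∧ y < 2 * (j + 1) + 1 ∧ Even y := by
      intro x y
      simp only [Y, Finset.mem_image, Finset.mem_range, Prod.mk.injEq, Int.even_iff]
      constructor
      · rintro ⟨k, hk, rfl, rfl⟩; omega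
      · rintro ⟨rfl, h0, h1, h2⟩; exact ⟨(y / 2).toNat, by omega, rfl, by omega⟩
    have hX : ∀ x y : ℤ, (x, y) ∈ X ↔ y = 0 ∧ 0 < x ∧ x < 2 * (j + 1) ∧ Even x := by
      intro x y
      simp only [X, Finset.mem_image, Finset.mem_range, Prod.mk.injEq, Int.even_iff]
      constructor
      · rintro ⟨k, hk, rfl, rfl⟩; omega
      · rintro ⟨rfl, h0, h1, h2⟩; exact ⟨(x / 2 - 1).toNat, by omega, by omega, rfl⟩
    have cY : Y.card = j + 2 := by
      rw [Finset.card_image_of_injective, Finset.card_range]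
      intro a b h
      simpa using h
    have cX : X.card = j := by
      rw [Finset.card_image_of_injective, Finset.card_range]
      intro a b h
      simpa using h
    have dXY : Disjoint X Y := by
      rw [Finset.disjoint_left]
      rintro ⟨x, y⟩ h h'
      rw [hX] at h
      rw [hY] at h'
      omega
    have dP : Disjoint P (X ∪ Y) := by
      rw [Finset.disjoint_left]
      rintro ⟨x, y⟩ h h'
      rw [hP] at h
      rw [Finset.mem_union, hX, hY] at h'
      omega
    refine ⟨(P ∪ (X ∪ Y)).image fun p => (p.2 + 1, p.1 + 1), ?_, fun x y => ?_⟩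
    · rw [Finset.card_image_of_injective, Finset.card_union_of_disjoint dP,
        Finset.card_union_of_disjoint dXY, hc, cX, cY]
      · ring
      · rintro ⟨a, b⟩ ⟨c, d⟩ h
        simp only [Prod.mk.injEq] at h ⊢
        omega
    · have hmem : (x, y) ∈ (P ∪ (X ∪ Y)).image (fun p => (p.2 + 1, p.1 + 1)) ↔
          (y - 1, x - 1) ∈ P ∪ (X ∪ Y) := by
        rw [Finset.mem_image]
        constructor
        · rintro ⟨⟨a, b⟩, h, h'⟩
          simp only [Prod.mk.injEq] at h'
          obtain ⟨rfl, rfl⟩ := h'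
          simpa using h
        · exact fun h => ⟨_, h, by simp⟩
      rw [hmem, Finset.mem_union, Finset.mem_union, hP, hX, hY]
      by_cases hx : 0 < x
      swap
      · omega
      by_cases hy : 0 < y
      swap
      · omega
      rw [belowCorner_add_two j x y (by omega)]
      simp only [Int.even_iff]
      by_cases hx1 : x - 1 = 0
      · rw [hx1, belowCorner_zero_right]
        by_cases hy1 : y - 1 = 0 <;> omega
      · by_cases hy1 : y - 1 = 0
        · rw [hy1, belowCorner_zero_left]
          omega
        · rw [show (y - 1 + (x - 1)) % 2 = (x + y) % 2 by omega]
          have : 0 < x - 1 := by omega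
          have : 0 < y - 1 := by omega
          tauto

/-- The even points in the half-open square `(0, 2j) × (-2j, 0]`. -/
lemma exists_finset_lower (j : ℕ) :
    ∃ Q : Finset (ℤ × ℤ), Q.card = (2 * j - 1) * j ∧
      ∀ x y : ℤ, (x, y) ∈ Q ↔
        0 < x ∧ x < 2 * j ∧ -(2 * j) < y ∧ y ≤ 0 ∧ Even (x + y) := by
  refine ⟨(Finset.Ioo (0 : ℤ) (2 * j) ×ˢ Finset.range j).image
    fun p => (p.1, -(2 * (p.2 : ℤ) + p.1 % 2)), ?_, fun x y => ?_⟩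
  · rw [Finset.card_image_of_injective, Finset.card_product, Int.card_Ioo, Finset.card_range]
    · congr 1
      omega
    · rintro ⟨a, b⟩ ⟨c, d⟩ h
      simp only [Prod.mk.injEq] at h ⊢
      obtain ⟨rfl, h⟩ := h
      omega
  · simp only [Finset.mem_image, Finset.mem_product, Finset.mem_Ioo, Finset.mem_range,
      Prod.mk.injEq, Prod.exists, Int.even_iff]
    constructor
    · rintro ⟨a, b, h, rfl, rfl⟩; omega
    · intro h
      exact ⟨x, (-y / 2).toNat, by omega, rfl, by omega⟩

lemma mem_Rreg (j : ℕ) (p : ℝ × ℝ) :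
    p ∈ Rreg j ↔ ∃ i, 1 ≤ i ∧ i ≤ j + 1 ∧
      (0 ≤ p.1 ∧ p.1 ≤ (ab j i).1) ∧ 0 ≤ p.2 ∧ p.2 ≤ (ab j i).2 := by
  simp only [Rreg, Set.mem_iUnion, Finset.mem_Icc, Set.mem_prod, Set.mem_Icc, exists_prop,
    and_assoc]

lemma mem_interior_region (j : ℕ) (x y : ℝ) :
    (x, y) ∈ interior (Rreg (j + 1) ∪
        Set.Icc (0 : ℝ) (2 * ((j + 1 : ℕ) : ℝ)) ×ˢ
          Set.Icc (-(2 * ((j + 1 : ℕ) : ℝ))) (0 : ℝ)) ↔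
      (0 < x ∧ x < 2 * ((j + 1 : ℕ) : ℝ) ∧ -(2 * ((j + 1 : ℕ) : ℝ)) < y ∧ y ≤ 0) ∨
      (0 < x ∧ 0 < y ∧
        ∃ i, 1 ≤ i ∧ i ≤ j + 2 ∧ x < (ab (j + 1) i).1 ∧ y < (ab (j + 1) i).2) := by
  have hfst : ∀ i, 1 ≤ i → i ≤ j + 2 →
      ((ab (j + 1) i).1 : ℝ) ≤ 2 * ((j + 1 : ℕ) : ℝ) := fun i h1 h2 => by
    exact_mod_cast (ab_bounds j i h1 h2).2.1
  constructor
  · intro h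
    rw [mem_interior_iff_mem_nhds, Metric.mem_nhds_iff] at h
    obtain ⟨ε, hε, hball⟩ := h
    have key : ∀ δ : ℝ, |δ| < ε → (x + δ, y + δ) ∈ Rreg (j + 1) ∪
        Set.Icc (0 : ℝ) (2 * ((j + 1 : ℕ) : ℝ)) ×ˢ
          Set.Icc (-(2 * ((j + 1 : ℕ) : ℝ))) (0 : ℝ) := by
      intro δ hδ
      apply hball
      simp [Prod.dist_eq, hδ]
    have hlo := key (-(ε / 2)) (by rw [abs_neg, abs_of_pos (by positivity)]; linarith)
    have hhi := key (ε / 2) (by rw [abs_of_pos (by positivity)]; linarith)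
    simp only [Set.mem_union, mem_Rreg, Set.mem_prod, Set.mem_Icc] at hlo hhi
    have hj : (0 : ℝ) ≤ ((j + 1 : ℕ) : ℝ) := by positivity
    have hx : 0 < x := by
      rcases hlo with ⟨i, -, -, h, -⟩ | h <;> linarith [h.1]
    have hy : -(2 * ((j + 1 : ℕ) : ℝ)) < y := by
      rcases hlo with ⟨i, -, -, -, h⟩ | ⟨-, h⟩ <;> linarith [h.1]
    by_cases hy0 : y ≤ 0
    · refine Or.inl ⟨hx, ?_, hy, hy0⟩
      rcases hhi with ⟨i, h1, h2, h, -⟩ | h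
      · linarith [h.2, hfst i h1 h2]
      · linarith [h.1.2]
    · push Not at hy0
      refine Or.inr ⟨hx, hy0, ?_⟩
      rcases hhi with ⟨i, h1, h2, h, h'⟩ | h
      · exact ⟨i, h1, h2, by linarith [h.2], by linarith [h'.2]⟩
      · linarith [h.2.2]
  · rintro (⟨hx, hx', hy, hy'⟩ | ⟨hx, hy, i, h1, h2, ha, hb⟩)
    · refine mem_interior.2 ⟨Set.Ioo 0 (2 * ((j + 1 : ℕ) : ℝ)) ×ˢ
        Set.Ioo (-(2 * ((j + 1 : ℕ) : ℝ))) 1, ?_, isOpen_Ioo.prod isOpen_Ioo,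
        ⟨⟨hx, hx'⟩, hy, by linarith⟩⟩
      rintro ⟨u, v⟩ ⟨⟨hu, hu'⟩, hv, hv'⟩
      by_cases hv0 : v ≤ 0
      · exact Or.inr ⟨⟨hu.le, hu'.le⟩, hv.le, hv0⟩
      · have e : ((ab (j + 1) (j + 2)).1 : ℝ) = 2 * ((j + 1 : ℕ) : ℝ) := by
          exact_mod_cast ab_last_fst j
        have e' : (1 : ℝ) ≤ ((ab (j + 1) (j + 2)).2 : ℝ) := by
          exact_mod_cast (ab_bounds j (j + 2) (by omega) le_rfl).2.2.1
        refine Or.inl ((mem_Rreg _ _).2 ⟨j + 2, by omega, le_rfl, ⟨hu.le, ?_⟩, ?_, ?_⟩)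
        · rw [e]; exact hu'.le
        · exact (not_le.1 hv0).le
        · exact hv'.le.trans e'
    · refine mem_interior.2 ⟨Set.Ioo 0 ((ab (j + 1) i).1 : ℝ) ×ˢ
        Set.Ioo 0 ((ab (j + 1) i).2 : ℝ), ?_, isOpen_Ioo.prod isOpen_Ioo,
        ⟨⟨hx, ha⟩, hy, hb⟩⟩
      rintro ⟨u, v⟩ ⟨⟨hu, hu'⟩, hv, hv'⟩
      exact Or.inl ((mem_Rreg _ _).2 ⟨i, h1, h2, ⟨hu.le, hu'.le⟩, hv.le, hv'.le⟩)

/-- For every integer `j ≥ 1`, the number of even lattice points in the interior of the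
region `R(j) ∪ ([0,2j] × [−2j,0])` of the intermediate curve `P_m(j)` equals `3j² − 2j`,
the Seifert genus of the cable knot `C(T(2,3); j, 6j+1)` of the trefoil. -/
theorem stmt_15 (j : ℕ) (hj : 1 ≤ j) :
    Set.ncard {p : ℝ × ℝ | IsEvenLatticePt p ∧
        p ∈ interior (Rreg j ∪
          Set.Icc (0 : ℝ) (2 * (j : ℝ)) ×ˢ Set.Icc (-(2 * (j : ℝ))) (0 : ℝ))} =
      3 * j ^ 2 - 2 * j := by
  obtain ⟨j, rfl⟩ : ∃ k, j = k + 1 := ⟨j - 1, by omega⟩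
  obtain ⟨P, hPc, hP⟩ := exists_finset_upper j
  obtain ⟨Q, hQc, hQ⟩ := exists_finset_lower (j + 1)
  have hd : Disjoint P Q := by
    rw [Finset.disjoint_left]
    rintro ⟨x, y⟩ h h'
    rw [hP] at h
    rw [hQ] at h'
    omega
  have hmem : ∀ x y : ℤ, ((x : ℝ), (y : ℝ)) ∈ interior (Rreg (j + 1) ∪
        Set.Icc (0 : ℝ) (2 * ((j + 1 : ℕ) : ℝ)) ×ˢ
          Set.Icc (-(2 * ((j + 1 : ℕ) : ℝ))) (0 : ℝ)) ∧ Even (x + y) ↔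
      (x, y) ∈ P ∪ Q := by
    intro x y
    rw [mem_interior_region, Finset.mem_union, hP, hQ, BelowCorner]
    norm_cast
    rw [show j + 1 + 1 = j + 2 from rfl]
    generalize (∃ i, 1 ≤ i ∧ i ≤ j + 2 ∧ x < (ab (j + 1) i).1 ∧ y < (ab (j + 1) i).2) = B
    tauto
  have himage : {p : ℝ × ℝ | IsEvenLatticePt p ∧
      p ∈ interior (Rreg (j + 1) ∪
        Set.Icc (0 : ℝ) (2 * ((j + 1 : ℕ) : ℝ)) ×ˢ
          Set.Icc (-(2 * ((j + 1 : ℕ) : ℝ))) (0 : ℝ))} =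
      (Prod.map (Int.cast : ℤ → ℝ) (Int.cast : ℤ → ℝ)) '' (↑(P ∪ Q) : Set (ℤ × ℤ)) := by
    ext ⟨a, b⟩
    constructor
    · rintro ⟨⟨x, y, hx, hy, he⟩, h⟩
      dsimp only at hx hy
      subst hx hy
      exact ⟨(x, y), (hmem x y).1 ⟨h, he⟩, rfl⟩
    · rintro ⟨⟨x, y⟩, h, h'⟩
      simp only [Prod.map_apply, Prod.mk.injEq] at h'
      obtain ⟨rfl, rfl⟩ := h'
      have := (hmem x y).2 h
      exact ⟨⟨x, y, rfl, rfl, this.2⟩, this.1⟩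
  rw [himage, Set.ncard_image_of_injective _ (Int.cast_injective.prodMap Int.cast_injective),
    Set.ncard_coe_finset, Finset.card_union_of_disjoint hd, hPc, hQc,
    show 2 * (j + 1) - 1 = 2 * j + 1 by omega]
  apply Nat.eq_sub_of_add_eq
  ring
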